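/- Let p, q ∈ ℤ² with p∧q ≠ 0 and suppose q is of type I₊ relative to p. Then there exists ν₀ᵖ > 0 such that for every ν ∈ (0, ν₀ᵖ) there exist λ > 0 and a sequence w:ℤ→ℝ, not identically zero, belonging to ℓ²_s(ℤ) for every s ≥ 0, with w_n = 0 for all n > 1, satisfying ρ_{n−1}w_{n−1} − ρ_{n+1}w_{n+1} − ν‖q+np‖² w_n = λ w_n for all n ∈ ℤ. Moreover, for every such ν and every λ > 0, λ admits an eigenvector satisfying the I₊ sign property if and only if a₀(λ,ν) + g(λ,ν) = 0, where g(λ,ν) = lim_{k→∞}[a_{−1}(λ,ν);…;a_{−k}(λ,ν)]. -/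

import Mathlib

open Filter Finset Topology

noncomputable section

/-- Squared Euclidean norm of an integer vector. -/
def nsq (v : ℤ × ℤ) : ℝ := (v.1 : ℝ) ^ 2 + (v.2 : ℝ) ^ 2

/-- Wedge (cross) product of two integer vectors. -/
def wedge (p q : ℤ × ℤ) : ℤ := p.1 * q.2 - p.2 * q.1

/-- The lattice point `q + n • p`. -/
def pt (q p : ℤ × ℤ) (n : ℤ) : ℤ × ℤ := (q.1 + n * p.1, q.2 + n * p.2)

/-- ρ_n = 1 - ‖p‖²/‖q+np‖². -/
def rho (p q : ℤ × ℤ) (n : ℤ) : ℝ := 1 - nsq p / nsq (pt q p n)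

/-- `q` is of type I₀ relative to `p`. -/
def typeI0 (p q : ℤ × ℤ) : Prop :=
  nsq q < nsq p ∧ ∀ n : ℤ, n ≠ 0 → nsq p < nsq (pt q p n)

/-- a_n(λ,ν) = (λ + ν‖q+np‖²)/ρ_n. -/
def acoef (p q : ℤ × ℤ) (lam ν : ℝ) (n : ℤ) : ℝ :=
  (lam + ν * nsq (pt q p n)) / rho p q n

/-- Membership in the weighted space ℓ²_s(ℤ). -/
def memL2s (s : ℝ) (w : ℤ → ℝ) : Prop :=
  Summable fun n : ℤ => (1 + |(n : ℝ)| ^ (2 * s)) * (w n) ^ 2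

/-- Finite continued fraction `[x₁; x₂; …; x_k] = 1/(x₁ + 1/(x₂ + ⋯ + 1/x_k))`. -/
def cfL : List ℝ → ℝ
  | [] => 0
  | x :: xs => 1 / (x + cfL xs)

/-- `q` is of type I₊ relative to `p`. -/
def typeIp (p q : ℤ × ℤ) : Prop :=
  nsq q < nsq p ∧ nsq (pt q p 1) = nsq p ∧
    ∀ n : ℤ, n ≠ 0 → n ≠ 1 → nsq p < nsq (pt q p n)

/-- The I₊ sign pattern for an eigenvector sequence. -/
def signIp (w : ℤ → ℝ) : Prop :=
  (∀ n : ℤ, 1 < n → w n = 0) ∧ 0 < w 1 ∧ w (-1) < 0 ∧ w 0 < 0 ∧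
    ∀ n : ℤ, n ≤ -2 → 0 < (-1 : ℝ) ^ n.natAbs * w n


lemma cfs_step (A : ℕ → ℝ) (n : ℕ) :
    cfL ((List.range (n+1)).map A) = 1 / (A 0 + cfL ((List.range n).map (fun j => A (j+1)))) := by
  rw [List.range_succ_eq_map]
  simp [cfL, Function.comp_def]

lemma cfs_nonneg (n : ℕ) : ∀ (A : ℕ → ℝ), (∀ j, 0 < A j) → 0 ≤ cfL ((List.range n).map A) := by
  induction n with
  | zero => intro A _; simp [cfL]
  | succ n ih =>
    intro A hA
    rw [cfs_step]
    have h1 := ih (fun j => A (j+1)) (fun j => hA _)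
    have h2 := hA 0
    positivity

lemma cfs_le (n : ℕ) (A : ℕ → ℝ) (c : ℝ) (hc : 0 < c) (hA : ∀ j, c ≤ A j) :
    cfL ((List.range n).map A) ≤ 1 / c := by
  have hp : ∀ j, 0 < A j := fun j => hc.trans_le (hA j)
  cases n with
  | zero => simp [cfL]; positivity
  | succ n =>
    rw [cfs_step]
    have h1 := cfs_nonneg n (fun j => A (j+1)) (fun j => hp _)
    have h2 := hA 0
    apply one_div_le_one_div_of_le hc
    linarith

lemma two_step (c x y s t : ℝ) (hc : 0 < c) (hx : c ≤ x) (hy : c ≤ y) (hs : 0 ≤ s) (ht : 0 ≤ t) :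
    |1 / (x + 1 / (y + s)) - 1 / (x + 1 / (y + t))| ≤ (1 / (1 + c^2)) * |s - t| := by
  have hx0 : 0 < x := hc.trans_le hx
  have hy0 : 0 < y := hc.trans_le hy
  have hys : 0 < y + s := by linarith
  have hyt : 0 < y + t := by linarith
  have h1 : 1 + c^2 ≤ x * (y + s) + 1 := by
    have : c * c ≤ x * (y + s) := mul_le_mul hx (by linarith) hc.le hx0.le
    nlinarith
  have h2 : 1 ≤ x * (y + t) + 1 := by nlinarith [mul_pos hx0 hyt]
  have e : 1 / (x + 1 / (y + s)) - 1 / (x + 1 / (y + t))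
      = (s - t) / ((x * (y + s) + 1) * (x * (y + t) + 1)) := by
    have : x * (y+s) + 1 ≠ 0 := by positivity
    have : x * (y+t) + 1 ≠ 0 := by positivity
    have e1 : 1 / (x + 1 / (y + s)) = (y + s) / (x * (y + s) + 1) := by field_simp
    have e2 : 1 / (x + 1 / (y + t)) = (y + t) / (x * (y + t) + 1) := by field_simp
    rw [e1, e2]
    field_simp
    ring
  rw [e, abs_div, abs_of_pos (by positivity : 0 < (x * (y + s) + 1) * (x * (y + t) + 1)),
    div_eq_mul_inv, mul_comm, ← one_div]
  apply mul_le_mul_of_nonneg_right _ (abs_nonneg _)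
  apply one_div_le_one_div_of_le (by positivity)
  nlinarith [sq_nonneg c]

lemma cfs_cauchy (c : ℝ) (hc : 0 < c) (k : ℕ) : ∀ (A : ℕ → ℝ), (∀ j, c ≤ A j) → ∀ n m : ℕ,
    2 * k ≤ n → 2 * k ≤ m →
    |cfL ((List.range n).map A) - cfL ((List.range m).map A)| ≤ (1 / (1 + c^2))^k * (1 / c) := by
  induction k with
  | zero =>
    intro A hA n m _ _
    have hp : ∀ j, 0 < A j := fun j => hc.trans_le (hA j)
    have := cfs_nonneg n A hp
    have := cfs_nonneg m A hp
    have := cfs_le n A c hc hA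
    have := cfs_le m A c hc hA
    rw [pow_zero, one_mul, abs_le]
    constructor <;> linarith
  | succ k ih =>
    intro A hA n m hn hm
    obtain ⟨n, rfl⟩ : ∃ n', n = n' + 1 + 1 := ⟨n - 2, by omega⟩
    obtain ⟨m, rfl⟩ : ∃ n', m = n' + 1 + 1 := ⟨m - 2, by omega⟩
    rw [cfs_step, cfs_step, cfs_step, cfs_step]
    have hp : ∀ j, 0 < A j := fun j => hc.trans_le (hA j)
    refine (two_step c _ _ _ _ hc (hA _) (hA _) (cfs_nonneg _ _ (fun j => hp _))
      (cfs_nonneg _ _ (fun j => hp _))).trans ?_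
    rw [pow_succ' _ k, mul_assoc]
    exact mul_le_mul_of_nonneg_left (ih _ (fun j => hA _) n m (by omega) (by omega)) (by positivity)

lemma cfs_rate (c : ℝ) (hc : 0 < c) (k : ℕ) : ∀ (A T : ℕ → ℝ), (∀ j, c ≤ A j) →
    (∀ j, 0 ≤ T j) → (∀ j, T j = 1 / (A j + T (j+1))) → ∀ n : ℕ,
    2 * k ≤ n → |cfL ((List.range n).map A) - T 0| ≤ (1 / (1 + c^2))^k * (1 / c) := by
  induction k with
  | zero =>
    intro A T hA hT0 hT n _
    have hp : ∀ j, 0 < A j := fun j => hc.trans_le (hA j)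
    have := cfs_nonneg n A hp
    have := cfs_le n A c hc hA
    have := hT0 0
    have : T 0 ≤ 1 / c := by
      rw [hT 0]
      apply one_div_le_one_div_of_le hc
      linarith [hA 0, hT0 (0+1)]
    rw [pow_zero, one_mul, abs_le]
    constructor <;> linarith
  | succ k ih =>
    intro A T hA hT0 hT n hn
    obtain ⟨n, rfl⟩ : ∃ n', n = n' + 1 + 1 := ⟨n - 2, by omega⟩
    rw [cfs_step, cfs_step, hT 0, hT (0+1)]
    have hp : ∀ j, 0 < A j := fun j => hc.trans_le (hA j)
    refine (two_step c _ _ _ _ hc (hA _) (hA _) (cfs_nonneg _ _ (fun j => hp _))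
      (hT0 _)).trans ?_
    rw [pow_succ' _ k, mul_assoc]
    exact mul_le_mul_of_nonneg_left (ih (fun j => A (j+1+1)) (fun j => T (j+1+1)) (fun j => hA _)
      (fun j => hT0 _) (fun j => hT _) n (by omega)) (by positivity)

lemma rate_tendsto (c : ℝ) (hc : 0 < c) :
    Tendsto (fun k : ℕ => (1 / (1 + c^2))^k * (1 / c)) atTop (𝓝 0) := by
  have h : Tendsto (fun k : ℕ => (1 / (1 + c^2))^k) atTop (𝓝 0) := by
    apply tendsto_pow_atTop_nhds_zero_of_lt_one (by positivity)
    rw [div_lt_one (by positivity)]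
    nlinarith [sq_pos_of_pos hc]
  simpa using h.mul_const (1/c)

lemma cfs_conv (c : ℝ) (hc : 0 < c) (A : ℕ → ℝ) (hA : ∀ j, c ≤ A j) :
    ∃ G : ℝ, Tendsto (fun n => cfL ((List.range n).map A)) atTop (𝓝 G) := by
  apply cauchySeq_tendsto_of_complete
  rw [Metric.cauchySeq_iff]
  intro ε hε
  obtain ⟨k, hk⟩ := ((rate_tendsto c hc).eventually (gt_mem_nhds hε)).exists
  refine ⟨2 * k, fun m hm n hn => ?_⟩
  rw [Real.dist_eq]
  exact (cfs_cauchy c hc k A hA m n hm hn).trans_lt hk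

lemma cfs_tail (c : ℝ) (hc : 0 < c) (A : ℕ → ℝ) (hA : ∀ j, c ≤ A j) :
    ∃ G : ℕ → ℝ, (∀ j, 0 < G j) ∧ (∀ j, G j = 1 / (A j + G (j+1))) ∧
      Tendsto (fun n => cfL ((List.range n).map A)) atTop (𝓝 (G 0)) := by
  have hp : ∀ j, 0 < A j := fun j => hc.trans_le (hA j)
  have h := fun i : ℕ => cfs_conv c hc (fun j => A (j + i)) (fun j => hA _)
  choose G hG using h
  have h0 : ∀ j, 0 ≤ G j := fun j =>
    ge_of_tendsto' (hG j) (fun n => cfs_nonneg n _ (fun _ => hp _))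
  have hr : ∀ j, G j = 1 / (A j + G (j+1)) := by
    intro j
    have h1 := (hG j).comp (tendsto_add_atTop_nat 1)
    have hne : A j + G (j+1) ≠ 0 := by have := hp j; have := h0 (j+1); positivity
    have h2 : Tendsto (fun n => 1 / (A j + cfL ((List.range n).map (fun i => A (i + (j + 1))))))
        atTop (𝓝 (1 / (A j + G (j+1)))) :=
      tendsto_const_nhds.div ((hG (j+1)).const_add (A j)) hne
    refine tendsto_nhds_unique h1 (h2.congr fun n => ?_)
    simp only [Function.comp_def]
    rw [cfs_step]
    simp only [zero_add]
    congr 5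
    funext i
    congr 1
    ring
  refine ⟨G, fun j => ?_, hr, hG 0⟩
  rw [hr j]
  have := hp j; have := h0 (j+1); positivity

lemma lower (A G : ℕ → ℝ) (hA : ∀ j, 0 < A j) (hG : ∀ j, 0 < G j)
    (hr : ∀ j, G j = 1 / (A j + G (j+1))) (m : ℕ) :
    (∑ i ∈ range m, A (2*i+1)) ≤
      G 0 * (1 + (∑ i ∈ range m, A (2*i+1)) * (∑ i ∈ range m, A (2*i))) := by
  obtain ⟨y, hy0, hys⟩ : ∃ y : ℕ → ℝ, y 0 = 1 ∧ ∀ j, y (j+1) = y j * G j :=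
    ⟨fun j => ∏ i ∈ range j, G i, by simp, fun j => by simp [prod_range_succ]⟩
  have ypos : ∀ j, 0 < y j := by
    intro j
    induction j with
    | zero => rw [hy0]; norm_num
    | succ j ih => rw [hys]; exact mul_pos ih (hG j)
  have hrec : ∀ j, y (j+2) = y j - A j * y (j+1) := by
    intro j
    have h := hr j
    have : A j + G (j+1) ≠ 0 := (add_pos (hA j) (hG _)).ne'
    rw [eq_div_iff this] at h
    rw [hys (j+1), hys j]
    linear_combination y j * h
  have dec : ∀ j, y (j+2) ≤ y j := by
    intro j
    rw [hrec j]
    nlinarith [mul_pos (hA j) (ypos (j+1))]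
  have odd : ∀ i, y (2*i+1) ≤ y 1 := by
    intro i
    induction i with
    | zero => simp
    | succ i ih => exact (dec (2*i+1)).trans ih
  have even : ∀ i, 1 - y 1 * (∑ i ∈ range i, A (2*i)) ≤ y (2*i) := by
    intro i
    induction i with
    | zero => simp [hy0]
    | succ i ih =>
      have e : y (2*(i+1)) = y (2*i) - A (2*i) * y (2*i+1) := hrec (2*i)
      rw [e, sum_range_succ]
      nlinarith [mul_le_mul_of_nonneg_left (odd i) (hA (2*i)).le]
  have emono : ∀ i, i ≤ m → 1 - y 1 * (∑ i ∈ range m, A (2*i)) ≤ y (2*i) := by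
    intro i hi
    refine le_trans ?_ (even i)
    have : ∑ i ∈ range i, A (2*i) ≤ ∑ i ∈ range m, A (2*i) :=
      sum_le_sum_of_subset_of_nonneg (range_mono hi) (fun _ _ _ => (hA _).le)
    nlinarith [mul_le_mul_of_nonneg_left this (ypos 1).le]
  have fin : ∀ i, i ≤ m → (∑ i ∈ range i, A (2*i+1)) * (1 - y 1 * (∑ i ∈ range m, A (2*i)))
      ≤ y 1 - y (2*i+1) := by
    intro i
    induction i with
    | zero => simp
    | succ i ih =>
      intro hi
      have h1 := ih (by omega)
      have h2 := emono (i+1) hi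
      have e : y (2*(i+1)+1) = y (2*i+1) - A (2*i+1) * y (2*(i+1)) := hrec (2*i+1)
      rw [e, sum_range_succ]
      nlinarith [mul_le_mul_of_nonneg_left h2 (hA (2*i+1)).le]
  have h := fin m le_rfl
  have e1 : y 1 = G 0 := by have := hys 0; rw [hy0] at this; simpa using this
  have := ypos (2*m+1)
  rw [e1] at h
  nlinarith

lemma cfs_cont (n : ℕ) : ∀ (A : ℝ → ℕ → ℝ) (S : Set ℝ), (∀ x ∈ S, ∀ j, 0 < A x j) →
    (∀ j, ContinuousOn (fun x => A x j) S) →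
    ContinuousOn (fun x => cfL ((List.range n).map (A x))) S := by
  induction n with
  | zero => intro A S _ _; simp [cfL]; exact continuousOn_const
  | succ n ih =>
    intro A S hp hc
    simp only [cfs_step]
    refine continuousOn_const.div ((hc 0).add (ih (fun x j => A x (j+1)) S
      (fun x hx j => hp x hx _) (fun j => hc _))) ?_
    intro x hx
    have := cfs_nonneg n (fun j => A x (j+1)) (fun j => hp x hx _)
    have := hp x hx 0
    positivity

lemma lim_cont (A : ℝ → ℕ → ℝ) (S : Set ℝ) (c : ℝ) (hc : 0 < c)
    (hA : ∀ x ∈ S, ∀ j, c ≤ A x j)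
    (hcont : ∀ j, ContinuousOn (fun x => A x j) S) (G : ℝ → ℕ → ℝ)
    (hG0 : ∀ x ∈ S, ∀ j, 0 < G x j) (hG : ∀ x ∈ S, ∀ j, G x j = 1 / (A x j + G x (j+1))) :
    ContinuousOn (fun x => G x 0) S := by
  have hu : TendstoUniformlyOn (fun (n : ℕ) x => cfL ((List.range n).map (A x)))
      (fun x => G x 0) atTop S := by
    rw [Metric.tendstoUniformlyOn_iff]
    intro ε hε
    obtain ⟨k, hk⟩ := ((rate_tendsto c hc).eventually (gt_mem_nhds hε)).exists
    filter_upwards [eventually_ge_atTop (2*k)] with n hn x hx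
    rw [dist_comm, Real.dist_eq]
    exact (cfs_rate c hc k (A x) (G x) (hA x hx) (fun j => (hG0 x hx j).le) (hG x hx) n hn).trans_lt hk
  exact hu.continuousOn (Frequently.of_forall fun n =>
    cfs_cont n A S (fun x hx j => hc.trans_le (hA x hx j)) hcont)

lemma decay_sq (y A G : ℕ → ℝ) (hA : ∀ j, 0 < A j) (hG : ∀ j, 0 < G j)
    (hr : ∀ j, G j = 1 / (A j + G (j+1))) (ypos : ∀ j, 0 < y j)
    (hys : ∀ j, y (j+1) = y j * G j) (hinf : ∀ᶠ j in atTop, 2 ≤ A j) :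
    ∃ C, ∀ᶠ j in atTop, y j ≤ C * (1/2)^j := by
  obtain ⟨J, hJ⟩ := eventually_atTop.1 hinf
  refine ⟨y J * 2^J, eventually_atTop.2 ⟨J, fun j hj => ?_⟩⟩
  induction j, hj using Nat.le_induction with
  | base =>
    rw [mul_assoc, ← mul_pow]; norm_num
  | succ j hj ih =>
    have hg : G j ≤ 1/2 := by
      rw [hr j]
      apply one_div_le_one_div_of_le (by norm_num)
      linarith [hJ j hj, hG (j+1)]
    rw [hys, pow_succ]
    nlinarith [mul_le_mul_of_nonneg_left hg (ypos j).le]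

lemma mem_of_decay (w : ℤ → ℝ) (hw : ∀ n : ℤ, 1 < n → w n = 0) (C : ℝ)
    (h : ∀ᶠ j : ℕ in atTop, |w (-(j:ℤ))| ≤ C * (1/2)^j) (s : ℝ) (hs : 0 ≤ s) : memL2s s w := by
  unfold memL2s
  apply Summable.of_nat_of_neg
  · apply summable_of_ne_finset_zero (s := range 2)
    intro b hb
    have : 1 < (b:ℤ) := by simp at hb; omega
    rw [hw _ this]; simp
  · obtain ⟨m, hm⟩ := exists_nat_ge (2*s)
    have hs1 : Summable (fun j : ℕ => C^2 * ((1/4:ℝ)^j + (j:ℝ)^m * (1/4:ℝ)^j)) := by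
      apply Summable.mul_left
      apply Summable.add
      · exact summable_geometric_of_lt_one (by norm_num) (by norm_num)
      · exact summable_pow_mul_geometric_of_norm_lt_one m (by norm_num)
    refine Summable.of_norm_bounded_eventually_nat hs1 ?_
    filter_upwards [h, eventually_ge_atTop 1] with j hj hj1
    have hj1' : (1:ℝ) ≤ j := by exact_mod_cast hj1
    have e : |((-(j:ℤ) : ℤ) : ℝ)| = j := by push_cast; rw [abs_neg]; simp
    rw [e]
    have h1 : (j:ℝ)^(2*s) ≤ (j:ℝ)^m := by
      rw [← Real.rpow_natCast]
      exact Real.rpow_le_rpow_of_exponent_le hj1' hm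
    have h0 : 0 ≤ (j:ℝ)^(2*s) := by positivity
    have h2 : (w (-(j:ℤ)))^2 ≤ C^2 * (1/4:ℝ)^j := by
      have : (w (-(j:ℤ)))^2 ≤ (C * (1/2)^j)^2 := by
        rw [← sq_abs]
        exact pow_le_pow_left₀ (abs_nonneg _) hj 2
      refine this.trans (le_of_eq ?_)
      rw [mul_pow, ← pow_mul, mul_comm j 2, pow_mul]; norm_num
    rw [Real.norm_of_nonneg (by positivity)]
    calc (1 + (j:ℝ)^(2*s)) * (w (-(j:ℤ)))^2 ≤ (1 + (j:ℝ)^m) * (C^2 * (1/4:ℝ)^j) := by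
          apply mul_le_mul (by linarith) h2 (sq_nonneg _) (by positivity)
      _ = _ := by ring

lemma build (R N : ℤ → ℝ) (lam ν r : ℝ) (hD : ∀ n, 0 < lam + ν * N n)
    (hr0 : 0 < r) (hR : ∀ n : ℤ, n ≤ -1 → r ≤ R n) (hR0 : R 0 < 0) (hR1 : R 1 = 0)
    (A G : ℕ → ℝ) (hAdef : ∀ j : ℕ, A j = (lam + ν * N (-1 - (j:ℤ))) / R (-1 - (j:ℤ)))
    (hinf : ∀ᶠ j in atTop, 2 ≤ A j) (hG : ∀ j, 0 < G j)
    (hr : ∀ j, G j = 1 / (A j + G (j+1)))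
    (heq : (lam + ν * N 0) / R 0 + G 0 = 0) :
    ∃ w : ℤ → ℝ, (∀ s : ℝ, 0 ≤ s → memL2s s w) ∧
      (∀ n : ℤ, R (n - 1) * w (n - 1) - R (n + 1) * w (n + 1) - ν * N n * w n = lam * w n) ∧
      signIp w := by
  have hRp : ∀ n : ℤ, n ≤ -1 → 0 < R n := fun n hn => hr0.trans_le (hR n hn)
  have hA : ∀ j, 0 < A j := fun j => by
    rw [hAdef]; exact div_pos (hD _) (hRp _ (by omega))
  obtain ⟨y, hy0, hys⟩ : ∃ y : ℕ → ℝ, y 0 = 1 ∧ ∀ j, y (j+1) = y j * G j :=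
    ⟨fun j => ∏ i ∈ range j, G i, by simp, fun j => by simp [prod_range_succ]⟩
  have ypos : ∀ j, 0 < y j := by
    intro j
    induction j with
    | zero => rw [hy0]; norm_num
    | succ j ih => rw [hys]; exact mul_pos ih (hG j)
  have hrec : ∀ j, y (j+2) = y j - A j * y (j+1) := by
    intro j
    have h := hr j
    have : A j + G (j+1) ≠ 0 := (add_pos (hA j) (hG _)).ne'
    rw [eq_div_iff this] at h
    rw [hys (j+1), hys j]
    linear_combination y j * h
  have hy1 : y 1 = G 0 := by have := hys 0; rw [hy0] at this; simpa using this
  obtain ⟨C, hC⟩ := decay_sq y A G hA hG hr ypos hys hinf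
  obtain ⟨w, w2, w1, wn⟩ : ∃ w : ℤ → ℝ, (∀ n : ℤ, 1 < n → w n = 0) ∧ w 1 = 1 / (lam + ν * N 1) ∧
      ∀ j : ℕ, w (-(j:ℤ)) = (-1)^j * y j / R (-(j:ℤ)) := by
    refine ⟨fun n => if 1 < n then 0 else if n = 1 then 1 / (lam + ν * N 1) else
      (-1)^n.natAbs * y n.natAbs / R n, ?_, ?_, ?_⟩
    · intro n hn; simp [hn]
    · simp
    · intro j
      have h1 : ¬ (1 < -(j:ℤ)) := by omega
      have h2 : ¬ (-(j:ℤ) = 1) := by omega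
      simp [h1, h2]
  have z0 : R 0 * w 0 = 1 := by
    have := wn 0
    simp only [Nat.cast_zero, neg_zero, pow_zero, hy0] at this
    rw [this]; field_simp [hR0.ne]
  have zn : ∀ j : ℕ, R (-(j:ℤ)) * w (-(j:ℤ)) = (-1)^j * y j := by
    intro j
    have : R (-(j:ℤ)) ≠ 0 := by
      rcases Nat.eq_zero_or_pos j with rfl | h
      · simpa using hR0.ne
      · exact (hRp _ (by omega)).ne'
    rw [wn]; field_simp
  refine ⟨w, ?_, ?_, w2, ?_, ?_, ?_, ?_⟩
  · refine fun s hs => mem_of_decay w w2 (C / r) ?_ s hs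
    filter_upwards [hC, eventually_ge_atTop 1] with j hj hj1
    have h1 := hR (-(j:ℤ)) (by omega)
    have h2 := hRp (-(j:ℤ)) (by omega)
    rw [wn, abs_div, abs_mul, abs_pow, abs_neg, abs_one, one_pow, one_mul, abs_of_pos (ypos j),
      abs_of_pos h2]
    calc y j / R (-(j:ℤ)) ≤ y j / r := div_le_div_of_nonneg_left (ypos j).le hr0 h1
      _ ≤ (C * (1/2)^j) / r := by gcongr
      _ = _ := by ring
  · intro n
    rcases lt_trichotomy n 1 with h | h | h
    · rcases eq_or_lt_of_le (show n ≤ 0 by omega) with h0 | h0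
      · subst h0
        have e1 := zn 1
        simp only [Nat.cast_one, pow_one, hy1] at e1
        simp only [zero_sub, zero_add, hR1, zero_mul]
        rw [e1]
        have : (lam + ν * N 0) * w 0 = (lam + ν * N 0) / R 0 := by
          rw [eq_div_iff hR0.ne]; linear_combination (lam + ν * N 0) * z0
        linear_combination -heq - this
      · obtain ⟨j, rfl⟩ : ∃ j : ℕ, n = -1 - (j:ℤ) := ⟨(-1 - n).toNat, by omega⟩
        have e0 := zn j
        have e1 := zn (j+1)
        have e2 := zn (j+2)
        rw [show -((j+1:ℕ):ℤ) = -1 - (j:ℤ) by push_cast; ring] at e1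
        rw [show -((j+2:ℕ):ℤ) = -1 - (j:ℤ) - 1 by push_cast; ring, hrec] at e2
        rw [show -(j:ℤ) = -1 - (j:ℤ) + 1 by ring] at e0
        have hAj := hAdef j
        rw [eq_div_iff (hRp (-1 - (j:ℤ)) (by omega)).ne'] at hAj
        rw [e0, e2]
        rw [pow_succ] at e1
        rw [pow_add]
        linear_combination (-A j) * e1 + (w (-1 - (j:ℤ))) * hAj
    · subst h
      have := hD 1
      simp only [sub_self, z0, w2 (1+1) (by norm_num), w1]
      field_simp
      ring
    · rw [w2 n h, w2 (n+1) (by omega)]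
      rcases eq_or_lt_of_le (show 2 ≤ n by omega) with h0 | h0
      · subst h0
        norm_num [hR1]
      · rw [w2 (n-1) (by omega)]; ring
  · rw [w1]; exact one_div_pos.2 (hD 1)
  · have := wn 1
    simp only [Nat.cast_one, pow_one] at this
    rw [this]
    exact div_neg_of_neg_of_pos (by linarith [ypos 1]) (hRp _ (by norm_num))
  · nlinarith
  · intro n hn
    obtain ⟨j, rfl⟩ : ∃ j : ℕ, n = -(j:ℤ) := ⟨n.natAbs, by omega⟩
    rw [wn, Int.natAbs_neg, Int.natAbs_natCast, ← mul_div_assoc, ← mul_assoc, ← mul_pow]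
    norm_num
    exact div_pos (ypos _) (hRp _ (by omega))

lemma conv_dir (R N : ℤ → ℝ) (lam ν c : ℝ) (hc : 0 < c)
    (hR : ∀ n : ℤ, n ≤ -1 → 0 < R n) (hR0 : R 0 < 0) (hR1 : R 1 = 0)
    (A : ℕ → ℝ) (hAdef : ∀ j : ℕ, A j = (lam + ν * N (-1 - (j:ℤ))) / R (-1 - (j:ℤ)))
    (hA : ∀ j, c ≤ A j) (G0 : ℝ)
    (hG : Tendsto (fun n => cfL ((List.range n).map A)) atTop (𝓝 G0))
    (w : ℤ → ℝ)
    (hw : ∀ n : ℤ, R (n - 1) * w (n - 1) - R (n + 1) * w (n + 1) - ν * N n * w n = lam * w n)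
    (hs : signIp w) : (lam + ν * N 0) / R 0 + G0 = 0 := by
  obtain ⟨-, -, s1, s0, sn⟩ := hs
  obtain ⟨y, hy⟩ : ∃ y : ℕ → ℝ, ∀ j : ℕ, y j = (-1)^j * (R (-(j:ℤ)) * w (-(j:ℤ))) := ⟨_, fun j => rfl⟩
  have ypos : ∀ j, 0 < y j := by
    intro j
    rw [hy]
    match j with
    | 0 => simp; exact mul_pos_of_neg_of_neg hR0 s0
    | 1 => simp; exact mul_neg_of_pos_of_neg (hR _ (by norm_num)) s1
    | j+2 =>
      have h := sn (-((j+2:ℕ):ℤ)) (by push_cast; omega)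
      rw [Int.natAbs_neg, Int.natAbs_natCast] at h
      have h2 := hR (-((j+2:ℕ):ℤ)) (by push_cast; omega)
      nlinarith [mul_pos h h2]
  have hrec : ∀ j, y j = A j * y (j+1) + y (j+2) := by
    intro j
    rw [hy, hy, hy]
    rw [show -((j+1:ℕ):ℤ) = -1 - (j:ℤ) by push_cast; ring]
    rw [show -((j+2:ℕ):ℤ) = -1 - (j:ℤ) - 1 by push_cast; ring]
    rw [show -(j:ℤ) = -1 - (j:ℤ) + 1 by ring]
    have hAj := hAdef j
    rw [eq_div_iff (hR (-1 - (j:ℤ)) (by omega)).ne'] at hAj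
    have h := hw (-1 - (j:ℤ))
    rw [pow_add, pow_add]
    linear_combination (-(-1)^j) * h + ((-1)^j * w (-1 - (j:ℤ))) * hAj
  have hT : ∀ j, y (j+1) / y j = 1 / (A j + y (j+1+1) / y (j+1)) := by
    intro j
    have h0 := ypos j
    have h1 := ypos (j+1)
    have h2 := ypos (j+2)
    have h3 : 0 < A j := hc.trans_le (hA j)
    have h4 : 0 < A j + y (j+1+1) / y (j+1) := by have := ypos (j+1+1); positivity
    rw [div_eq_div_iff h0.ne' h4.ne', hrec j]
    field_simp
  have hlim : Tendsto (fun k : ℕ => cfL ((List.range (2*k)).map A)) atTop (𝓝 (y 1 / y 0)) := by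
    rw [tendsto_iff_dist_tendsto_zero]
    refine squeeze_zero (fun _ => dist_nonneg) (fun k => ?_) (rate_tendsto c hc)
    rw [Real.dist_eq]
    exact cfs_rate c hc k A (fun j => y (j+1) / y j) hA
      (fun j => (div_pos (ypos _) (ypos _)).le) hT (2*k) le_rfl
  have h2k : Tendsto (fun k : ℕ => 2 * k) atTop atTop :=
    tendsto_id.const_mul_atTop' (by norm_num)
  have hE := tendsto_nhds_unique hlim (hG.comp h2k)
  rw [← hE]
  have h := hw 0
  have e0 := hy 0
  have e1 := hy 1
  have p0 := ypos 0
  simp only [zero_sub, zero_add, hR1, zero_mul, sub_zero] at h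
  simp at e0 e1
  have : y 1 = - ((lam + ν * N 0) / R 0) * y 0 := by
    rw [e0, e1]
    field_simp [hR0.ne]
    linear_combination -h
  rw [this]
  field_simp
  ring

lemma nsq_pt_pos (p q : ℤ × ℤ) (hpq : wedge p q ≠ 0) (n : ℤ) : 0 < nsq (pt q p n) := by
  unfold nsq pt
  by_contra h
  have h1 : ((q.1 + n * p.1 : ℤ) : ℝ) = 0 := by
    simp only at h
    nlinarith [sq_nonneg ((q.1 + n * p.1 : ℤ) : ℝ), sq_nonneg ((q.2 + n * p.2 : ℤ) : ℝ)]
  have h2 : ((q.2 + n * p.2 : ℤ) : ℝ) = 0 := by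
    simp only at h
    nlinarith [sq_nonneg ((q.1 + n * p.1 : ℤ) : ℝ), sq_nonneg ((q.2 + n * p.2 : ℤ) : ℝ)]
  have h1' : q.1 + n * p.1 = 0 := by exact_mod_cast h1
  have h2' : q.2 + n * p.2 = 0 := by exact_mod_cast h2
  apply hpq
  unfold wedge
  linear_combination p.1 * h2' - p.2 * h1'

lemma nsq_lt_succ (u v : ℤ × ℤ) (h : nsq u < nsq v) : nsq u + 1 ≤ nsq v := by
  unfold nsq at *
  have : u.1^2 + u.2^2 < v.1^2 + v.2^2 := by exact_mod_cast h
  have : u.1^2 + u.2^2 + 1 ≤ v.1^2 + v.2^2 := by omega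
  exact_mod_cast this

lemma nsq_growth (p q : ℤ × ℤ) (n : ℤ) :
    (n:ℝ)^2 * nsq p / 2 - nsq q ≤ nsq (pt q p n) := by
  unfold nsq pt
  push_cast
  nlinarith [sq_nonneg (2 * (q.1:ℝ) + n * p.1), sq_nonneg (2 * (q.2:ℝ) + n * p.2)]

/-- Instability of unidirectional flows of type I₊ for 2D Navier-Stokes, and the
characterization of unstable eigenvalues by `a₀(λ,ν) + g(λ,ν) = 0`. -/
theorem instability_NavierStokes_typeIplus (p q : ℤ × ℤ) (hpq : wedge p q ≠ 0)
    (hIp : typeIp p q) :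
    ∃ ν₀ > (0 : ℝ), ∀ ν : ℝ, 0 < ν → ν < ν₀ →
      (∃ lam > (0 : ℝ), ∃ w : ℤ → ℝ, w ≠ 0 ∧ (∀ s : ℝ, 0 ≤ s → memL2s s w) ∧
        (∀ n : ℤ, 1 < n → w n = 0) ∧
        ∀ n : ℤ, rho p q (n - 1) * w (n - 1) - rho p q (n + 1) * w (n + 1)
          - ν * nsq (pt q p n) * w n = lam * w n) ∧
      (∀ lam : ℝ, 0 < lam →
        ∃ G : ℝ,
          Tendsto (fun k : ℕ =>
              cfL ((List.range k).map fun j => acoef p q lam ν (-1 - (j : ℤ))))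
            atTop (nhds G) ∧
          ((∃ w : ℤ → ℝ, (∀ s : ℝ, 0 ≤ s → memL2s s w) ∧
              (∀ n : ℤ, rho p q (n - 1) * w (n - 1) - rho p q (n + 1) * w (n + 1)
                - ν * nsq (pt q p n) * w n = lam * w n) ∧
              (signIp w ∨ signIp (fun n => -w n))) ↔
            acoef p q lam ν 0 + G = 0)) := by
  obtain ⟨hq, h1, hn⟩ := hIp
  have hN := nsq_pt_pos p q hpq
  have hq0 : 0 ≤ nsq q := by unfold nsq; positivity
  have hP : 0 < nsq p := hq0.trans_lt hq
  have hpt0 : pt q p 0 = q := by simp [pt]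
  have hP1 : 1 ≤ nsq p := by
    have := nsq_lt_succ q p hq
    linarith
  have hNneg : ∀ n : ℤ, n ≤ -1 → nsq p < nsq (pt q p n) :=
    fun n h => hn n (by omega) (by omega)
  have hR : ∀ n : ℤ, n ≤ -1 → 1 / (nsq p + 1) ≤ rho p q n := by
    intro n h
    have h2 := nsq_lt_succ _ _ (hNneg n h)
    have h3 : nsq p / nsq (pt q p n) ≤ nsq p / (nsq p + 1) :=
      div_le_div_of_nonneg_left hP.le (by linarith) h2
    have h4 : 1 / (nsq p + 1) = 1 - nsq p / (nsq p + 1) := by field_simp; ring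
    unfold rho
    linarith
  have hr0 : 0 < 1 / (nsq p + 1) := by positivity
  have hRp : ∀ n : ℤ, n ≤ -1 → 0 < rho p q n := fun n h => hr0.trans_le (hR n h)
  have hRle : ∀ n : ℤ, rho p q n ≤ 1 := by
    intro n
    have : 0 < nsq p / nsq (pt q p n) := div_pos hP (hN n)
    unfold rho
    linarith
  have hR0 : rho p q 0 < 0 := by
    have h2 := hN 0
    unfold rho
    rw [hpt0] at h2 ⊢
    have := (one_lt_div h2).2 hq
    linarith
  have hR1 : rho p q 1 = 0 := by
    unfold rho
    rw [h1, div_self hP.ne', sub_self]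
  -- lower bound on the coefficients
  have hAlow : ∀ lam ν : ℝ, 0 < lam → 0 < ν → ∀ j : ℕ,
      lam + ν * nsq (pt q p (-1 - (j:ℤ))) ≤ acoef p q lam ν (-1 - (j:ℤ)) := by
    intro lam ν hl hν j
    have h2 := hN (-1 - (j:ℤ))
    unfold acoef
    rw [le_div_iff₀ (hRp _ (by omega))]
    have := hRle (-1 - (j:ℤ))
    have h3 : 0 < lam + ν * nsq (pt q p (-1 - (j:ℤ))) := by positivity
    nlinarith
  have hAlam : ∀ lam ν : ℝ, 0 < lam → 0 < ν → ∀ j : ℕ, lam ≤ acoef p q lam ν (-1 - (j:ℤ)) := by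
    intro lam ν hl hν j
    have h2 := mul_pos hν (hN (-1 - (j:ℤ)))
    linarith [hAlow lam ν hl hν j]
  have hAinf : ∀ lam ν : ℝ, 0 < lam → 0 < ν →
      ∀ᶠ j : ℕ in atTop, 2 ≤ acoef p q lam ν (-1 - (j:ℤ)) := by
    intro lam ν hl hν
    obtain ⟨J, hJ⟩ := exists_nat_ge (2 * (2 / ν + nsq q))
    filter_upwards [eventually_ge_atTop J] with j hj
    have hj' : (J:ℝ) ≤ j := by exact_mod_cast hj
    have hj0 : (0:ℝ) ≤ j := by positivity
    have h2 := nsq_growth p q (-1 - (j:ℤ))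
    push_cast at h2
    have h3 : (j:ℝ) ≤ (-1 - (j:ℝ))^2 := by nlinarith
    have h4 : (j:ℝ) ≤ (-1 - (j:ℝ))^2 * nsq p := by nlinarith
    have h5 : 2 / ν ≤ nsq (pt q p (-1 - (j:ℤ))) := by linarith
    have h6 : 2 ≤ ν * nsq (pt q p (-1 - (j:ℤ))) := by
      rw [div_le_iff₀ hν] at h5; linarith
    linarith [hAlow lam ν hl hν j]
  -- tails
  have htail := fun (lam ν : ℝ) (hl : 0 < lam) (hν : 0 < ν) =>
    cfs_tail lam hl (fun j : ℕ => acoef p q lam ν (-1 - (j:ℤ))) (hAlam lam ν hl hν)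
  have hbuild : ∀ lam ν : ℝ, 0 < lam → 0 < ν → ∀ G : ℕ → ℝ, (∀ j, 0 < G j) →
      (∀ j : ℕ, G j = 1 / (acoef p q lam ν (-1 - (j:ℤ)) + G (j+1))) →
      acoef p q lam ν 0 + G 0 = 0 →
      ∃ w : ℤ → ℝ, (∀ s : ℝ, 0 ≤ s → memL2s s w) ∧
        (∀ n : ℤ, rho p q (n - 1) * w (n - 1) - rho p q (n + 1) * w (n + 1)
          - ν * nsq (pt q p n) * w n = lam * w n) ∧ signIp w := by
    intro lam ν hl hν G hG hr heq
    exact build (rho p q) (fun n => nsq (pt q p n)) lam ν _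
      (fun n => by have := hN n; positivity) hr0 hR hR0 hR1
      (fun j : ℕ => acoef p q lam ν (-1 - (j:ℤ))) G (fun j => rfl) (hAinf lam ν hl hν) hG hr heq
  obtain ⟨m, hm⟩ := exists_nat_ge (2 / (-rho p q 0))
  have hB0 : 0 < -rho p q 0 := by linarith
  obtain ⟨C, hC⟩ : ∃ C : ℝ, ∀ ν : ℝ,
      (∑ i ∈ range m, acoef p q ν ν (-1 - ((2*i+1 : ℕ):ℤ))) *
        (∑ i ∈ range m, acoef p q ν ν (-1 - ((2*i : ℕ):ℤ))) = ν^2 * C := by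
    refine ⟨(∑ i ∈ range m, acoef p q 1 1 (-1 - ((2*i+1 : ℕ):ℤ))) *
        (∑ i ∈ range m, acoef p q 1 1 (-1 - ((2*i : ℕ):ℤ))), fun ν => ?_⟩
    have : ∀ n, acoef p q ν ν n = ν * acoef p q 1 1 n := by
      intro n; unfold acoef; ring
    simp only [this, ← mul_sum]
    ring
  refine ⟨1 / (1 + |C|), by positivity, fun ν hν hν0 => ⟨?_, ?_⟩⟩
  · -- existence
    have hG : ∀ lam : ℝ, ∃ G : ℕ → ℝ, 0 < lam → (∀ j, 0 < G j) ∧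
        (∀ j : ℕ, G j = 1 / (acoef p q lam ν (-1 - (j:ℤ)) + G (j+1))) := by
      intro lam
      by_cases hl : 0 < lam
      · obtain ⟨G, h1, h2, -⟩ := htail lam ν hl hν
        exact ⟨G, fun _ => ⟨h1, h2⟩⟩
      · exact ⟨0, fun h => absurd h hl⟩
    choose G hG using hG
    have hcont : ContinuousOn (fun lam => acoef p q lam ν 0 + G lam 0)
        (Set.Icc ν (ν + 1 + -rho p q 0)) := by
      refine ContinuousOn.add ?_ ?_
      · unfold acoef; fun_prop
      · refine lim_cont (fun lam (j:ℕ) => acoef p q lam ν (-1 - (j:ℤ))) _ ν hν ?_ ?_ G ?_ ?_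
        · intro x hx j
          exact hx.1.trans (hAlam x ν (hν.trans_le hx.1) hν j)
        · intro j; unfold acoef; fun_prop
        · intro x hx; exact (hG x (hν.trans_le hx.1)).1
        · intro x hx; exact (hG x (hν.trans_le hx.1)).2
    have hle : ν ≤ ν + 1 + -rho p q 0 := by linarith
    have hhi : acoef p q (ν + 1 + -rho p q 0) ν 0 + G (ν + 1 + -rho p q 0) 0 ≤ 0 := by
      set Λ := ν + 1 + -rho p q 0 with hΛ
      have hΛ0 : 0 < Λ := hν.trans_le hle
      have hΛ1 : 1 ≤ Λ := by linarith
      obtain ⟨g0, gr⟩ := hG Λ hΛ0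
      have e1 : G Λ 0 ≤ 1 / Λ := by
        rw [gr 0]
        apply one_div_le_one_div_of_le hΛ0
        linarith [hAlam Λ ν hΛ0 hν 0, g0 (0+1)]
      have e1' : 1 / Λ ≤ 1 := by rw [div_le_one hΛ0]; exact hΛ1
      have e2 : acoef p q Λ ν 0 ≤ -1 := by
        unfold acoef
        rw [div_le_iff_of_neg hR0]
        have := mul_pos hν (hN 0)
        linarith
      linarith
    have hlo : 0 ≤ acoef p q ν ν 0 + G ν 0 := by
      obtain ⟨g0, gr⟩ := hG ν hν
      have hL := lower (fun j : ℕ => acoef p q ν ν (-1 - (j:ℤ))) (G ν)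
        (fun j => hν.trans_le (hAlam ν ν hν hν j)) g0 gr m
      rw [hC ν] at hL
      have hC1 : ν^2 * C ≤ 1 := by
        rw [lt_div_iff₀ (by positivity)] at hν0
        have h2 : 0 ≤ ν * |C| := by positivity
        have h3 : C ≤ |C| := le_abs_self C
        have h4 : ν ≤ 1 := by nlinarith
        have h5 : ν * |C| ≤ 1 := by nlinarith
        have h6 : ν^2 * C ≤ ν^2 * |C| := mul_le_mul_of_nonneg_left h3 (sq_nonneg _)
        nlinarith
      have hO : (m:ℝ) * (ν + ν * nsq (pt q p 0)) ≤
          ∑ i ∈ range m, acoef p q ν ν (-1 - ((2*i+1 : ℕ):ℤ)) := by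
        rw [← nsmul_eq_mul]
        conv_lhs => rw [← card_range m]
        apply card_nsmul_le_sum
        intro i _
        have h2 := hNneg (-1 - ((2*i+1 : ℕ):ℤ)) (by omega)
        have h3 := hAlow ν ν hν hν (2*i+1)
        rw [hpt0]
        nlinarith
      have hx : 0 < ν + ν * nsq (pt q p 0) := by have := hN 0; positivity
      have h2 : 2 / (-rho p q 0) * (ν + ν * nsq (pt q p 0)) ≤ 2 * G ν 0 := by
        have := mul_le_mul_of_nonneg_right hm hx.le
        have := g0 0
        nlinarith
      have h3 : acoef p q ν ν 0 = - (1 / (-rho p q 0) * (ν + ν * nsq (pt q p 0))) := by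
        unfold acoef
        have := hR0.ne
        field_simp
      rw [h3]
      have h4 : 2 / (-rho p q 0) = 2 * (1 / (-rho p q 0)) := by ring
      rw [h4] at h2
      linarith
    obtain ⟨lam, hlam, hz⟩ := intermediate_value_Icc' hle hcont ⟨hhi, hlo⟩
    have hl : 0 < lam := hν.trans_le hlam.1
    obtain ⟨w, hw1, hw2, hw3⟩ := hbuild lam ν hl hν (G lam) (hG lam hl).1 (hG lam hl).2 hz
    refine ⟨lam, hl, w, ?_, hw1, hw3.1, hw2⟩
    rintro rfl
    exact lt_irrefl _ hw3.2.1
  · intro lam hl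
    obtain ⟨G, g0, gr, gl⟩ := htail lam ν hl hν
    refine ⟨G 0, ?_, ?_, ?_⟩
    · refine gl.congr fun k => ?_
      congr 1
      simp only [List.pure_def, List.bind_eq_flatMap, List.map_flatMap, List.map_cons, List.map_nil]
      induction List.range k with
      | nil => rfl
      | cons a l ih => simp [ih]
    · rintro ⟨w, -, hw, hs⟩
      have key : ∀ w : ℤ → ℝ, (∀ n : ℤ, rho p q (n - 1) * w (n - 1) - rho p q (n + 1) * w (n + 1)
          - ν * nsq (pt q p n) * w n = lam * w n) → signIp w → acoef p q lam ν 0 + G 0 = 0 :=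
        fun w hw hs => conv_dir (rho p q) (fun n => nsq (pt q p n)) lam ν lam hl hRp hR0 hR1
          (fun j : ℕ => acoef p q lam ν (-1 - (j:ℤ))) (fun j => rfl) (hAlam lam ν hl hν) (G 0) gl w hw hs
      rcases hs with hs | hs
      · exact key w hw hs
      · refine key (fun n => -w n) (fun n => ?_) hs
        linear_combination -(hw n)
    · intro heq
      obtain ⟨w, hw1, hw2, hw3⟩ := hbuild lam ν hl hν G g0 gr heq
      exact ⟨w, hw1, hw2, Or.inl hw3⟩
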